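/- Consider the pendulum-on-a-cart system with cart mass m > 0 and control force u : ℝ⁵ → ℝ continuous in all variables and locally Lipschitz in the state variables, and let t₀ ∈ ℝ. Suppose there exists a compact set B₀ contained in the open strip {(q,p) : 0 < q < π} such that every solution of the system starting at any time t ≥ t₀ at a point with (q,p) ∈ ∂B₀ immediately enters the interior: there is δ > 0 with (q(s), p(s)) ∈ int B₀ for all s ∈ (t, t + δ). Then there exists an initial condition (q₀, p₀, x₀, y₀) with (q₀, p₀) ∉ B₀ and 0 < q₀ < π such that every solution with this initial condition at time t₀ satisfies 0 < q(t) < π and (q(t), p(t)) ∉ B₀ for all t ≥ t₀ in its interval of existence. In particular, stabilization in the variables (q,p) alone (without assuming stability in x and y, nor the existence of a stable equilibrium) cannot be global. -/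

import Mathlib

open Real Set

/-- The `ṗ` component of the pendulum-on-a-cart vector field; state `z = (q, p, x, y)`. -/
noncomputable def cartPAcc (m : ℝ) (u : ℝ → ℝ → ℝ → ℝ → ℝ → ℝ)
    (z : ℝ × ℝ × ℝ × ℝ) (t : ℝ) : ℝ :=
  (u z.1 z.2.1 z.2.2.1 z.2.2.2 t * Real.sin z.1
    + z.2.1 ^ 2 * Real.sin z.1 * Real.cos z.1
    - (1 + m) * Real.cos z.1) / (m + (Real.cos z.1) ^ 2)

/-- The `ẏ` component of the pendulum-on-a-cart vector field; state `z = (q, p, x, y)`. -/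
noncomputable def cartYAcc (m : ℝ) (u : ℝ → ℝ → ℝ → ℝ → ℝ → ℝ)
    (z : ℝ × ℝ × ℝ × ℝ) (t : ℝ) : ℝ :=
  (u z.1 z.2.1 z.2.2.1 z.2.2.2 t
    + z.2.1 ^ 2 * Real.cos z.1
    - Real.sin z.1 * Real.cos z.1) / (m + (Real.cos z.1) ^ 2)

/-- `γ` solves `γ' = f t γ` on `[a, b]`. -/
def CPSol (f : ℝ → (ℝ × ℝ × ℝ × ℝ) → (ℝ × ℝ × ℝ × ℝ)) (a b : ℝ)
    (γ : ℝ → (ℝ × ℝ × ℝ × ℝ)) : Prop :=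
  ∀ t ∈ Icc a b, HasDerivWithinAt γ (f t (γ t)) (Icc a b) t

open scoped NNReal in
/-- Local Lipschitz property, uniform on compact time intervals. -/
def CPLip (f : ℝ → (ℝ × ℝ × ℝ × ℝ) → (ℝ × ℝ × ℝ × ℝ)) : Prop :=
  ∀ a b R : ℝ, ∃ K : ℝ≥0, ∀ t ∈ Icc a b, LipschitzOnWith K (f t) (Metric.closedBall 0 R)

/-- Coordinatewise clamping to the cube of radius `R`. -/
noncomputable def cpClamp (R : ℝ) (z : ℝ × ℝ × ℝ × ℝ) : ℝ × ℝ × ℝ × ℝ :=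
  (max (-R) (min R z.1), max (-R) (min R z.2.1), max (-R) (min R z.2.2.1),
    max (-R) (min R z.2.2.2))

lemma cpClamp_lip (R : ℝ) : LipschitzWith 1 (cpClamp R) := by
  have h : ∀ g : (ℝ × ℝ × ℝ × ℝ) → ℝ, LipschitzWith 1 g →
      LipschitzWith 1 fun z => max (-R) (min R (g z)) := fun g hg =>
    (hg.const_min R).const_max (-R)
  have h1 : LipschitzWith 1 (fun z : ℝ × ℝ × ℝ × ℝ => z.1) := LipschitzWith.prod_fst
  have h2 : LipschitzWith 1 (fun z : ℝ × ℝ × ℝ × ℝ => z.2.1) := by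
    have := LipschitzWith.prod_fst.comp (LipschitzWith.prod_snd (α := ℝ) (β := ℝ × ℝ × ℝ))
    rw [mul_one] at this
    exact this
  have h3' : LipschitzWith 1 (fun z : ℝ × ℝ × ℝ × ℝ => z.2.2) := by
    have := LipschitzWith.prod_snd.comp (LipschitzWith.prod_snd (α := ℝ) (β := ℝ × ℝ × ℝ))
    rw [mul_one] at this
    exact this
  have h3 : LipschitzWith 1 (fun z : ℝ × ℝ × ℝ × ℝ => z.2.2.1) := by
    have := LipschitzWith.prod_fst.comp h3'
    rw [mul_one] at this
    exact this
  have h4 : LipschitzWith 1 (fun z : ℝ × ℝ × ℝ × ℝ => z.2.2.2) := by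
    have := LipschitzWith.prod_snd.comp h3'
    rw [mul_one] at this
    exact this
  have := (h _ h1).prodMk ((h _ h2).prodMk ((h _ h3).prodMk (h _ h4)))
  simp only [max_self] at this
  exact this

lemma cpClamp_eq {R : ℝ} {z : ℝ × ℝ × ℝ × ℝ} (hz : ‖z‖ ≤ R) : cpClamp R z = z := by
  obtain ⟨q, p, x, y⟩ := z
  simp only [Prod.norm_def, Real.norm_eq_abs, sup_le_iff, abs_le] at hz
  obtain ⟨⟨h1, h1'⟩, ⟨h2, h2'⟩, ⟨h3, h3'⟩, ⟨h4, h4'⟩⟩ := hz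
  simp [cpClamp, *]

lemma cpClamp_norm {R : ℝ} (hR : 0 ≤ R) (z : ℝ × ℝ × ℝ × ℝ) : ‖cpClamp R z‖ ≤ R := by
  have h : ∀ x : ℝ, |max (-R) (min R x)| ≤ R := fun x =>
    abs_le.2 ⟨le_max_left _ _, max_le (by linarith) (min_le_left _ _)⟩
  simp only [cpClamp, Prod.norm_def, Real.norm_eq_abs, sup_le_iff]
  exact ⟨h _, h _, h _, h _⟩

lemma CPSol.cont {f : ℝ → (ℝ × ℝ × ℝ × ℝ) → (ℝ × ℝ × ℝ × ℝ)} {a b : ℝ}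
    {γ : ℝ → (ℝ × ℝ × ℝ × ℝ)} (h : CPSol f a b γ) : ContinuousOn γ (Icc a b) :=
  fun t ht => (h t ht).continuousWithinAt

lemma CPSol.mono {f : ℝ → (ℝ × ℝ × ℝ × ℝ) → (ℝ × ℝ × ℝ × ℝ)} {a b c : ℝ}
    {γ : ℝ → (ℝ × ℝ × ℝ × ℝ)} (h : CPSol f a b γ) (hc : c ≤ b) : CPSol f a c γ :=
  fun t ht => (h t ⟨ht.1, ht.2.trans hc⟩).mono (Icc_subset_Icc_right hc)

lemma CPSol.right {f : ℝ → (ℝ × ℝ × ℝ × ℝ) → (ℝ × ℝ × ℝ × ℝ)} {a b : ℝ}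
    {γ : ℝ → (ℝ × ℝ × ℝ × ℝ)} (h : CPSol f a b γ) :
    ∀ t ∈ Ico a b, HasDerivWithinAt γ (f t (γ t)) (Ici t) t := fun t ht =>
  (h t ⟨ht.1, ht.2.le⟩).mono_of_mem_nhdsWithin
    (Filter.mem_of_superset (Icc_mem_nhdsGE ht.2) (Icc_subset_Icc_left ht.1))

lemma CPSol.bdd {f : ℝ → (ℝ × ℝ × ℝ × ℝ) → (ℝ × ℝ × ℝ × ℝ)} {a b : ℝ}
    {γ : ℝ → (ℝ × ℝ × ℝ × ℝ)} (h : CPSol f a b γ) :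
    ∃ R : ℝ, 0 ≤ R ∧ ∀ t ∈ Icc a b, ‖γ t‖ ≤ R := by
  obtain ⟨C, hC⟩ := isCompact_Icc.exists_bound_of_continuousOn h.cont
  exact ⟨max C 0, le_max_right _ _, fun t ht => (hC t ht).trans (le_max_left _ _)⟩

lemma CPSol.unique {f : ℝ → (ℝ × ℝ × ℝ × ℝ) → (ℝ × ℝ × ℝ × ℝ)} (hf : CPLip f) {a b : ℝ}
    {γ γ' : ℝ → (ℝ × ℝ × ℝ × ℝ)} (h : CPSol f a b γ) (h' : CPSol f a b γ')
    (h0 : γ a = γ' a) : EqOn γ γ' (Icc a b) := by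
  obtain ⟨R, -, hR⟩ := h.bdd
  obtain ⟨R', -, hR'⟩ := h'.bdd
  obtain ⟨K, hK⟩ := hf a b (max R R')
  refine ODE_solution_unique_of_mem_Icc_right (v := f) (K := K)
    (s := fun _ => Metric.closedBall 0 (max R R')) (fun t ht => hK t ⟨ht.1, ht.2.le⟩)
    h.cont h.right (fun t ht => ?_) h'.cont h'.right (fun t ht => ?_) h0
  · simpa using Or.inl (hR t ⟨ht.1, ht.2.le⟩)
  · simpa using Or.inr (hR' t ⟨ht.1, ht.2.le⟩)

open scoped NNReal in
lemma cp_global {f : ℝ → (ℝ × ℝ × ℝ × ℝ) → (ℝ × ℝ × ℝ × ℝ)}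
    (hc : Continuous (Function.uncurry f)) (hf : CPLip f) {a b : ℝ} (hab : a ≤ b)
    {R : ℝ} (hR : 0 ≤ R) (z0 : ℝ × ℝ × ℝ × ℝ) :
    ∃ α : (ℝ × ℝ × ℝ × ℝ) → ℝ → (ℝ × ℝ × ℝ × ℝ),
      (∀ z ∈ Metric.closedBall z0 1,
        α z a = z ∧ CPSol (fun t z => f t (cpClamp R z)) a b (α z)) ∧
      ∃ L' : ℝ≥0, ∀ t ∈ Icc a b, LipschitzOnWith L' (α · t) (Metric.closedBall z0 1) := by
  obtain ⟨K, hK⟩ := hf a b R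
  obtain ⟨C, hC⟩ := (isCompact_Icc.prod (isCompact_closedBall (0 : ℝ × ℝ × ℝ × ℝ) R)).exists_bound_of_continuousOn
    (s := Icc a b ×ˢ Metric.closedBall (0 : ℝ × ℝ × ℝ × ℝ) R) hc.continuousOn
  have hPL : IsPicardLindelof (fun t z => f t (cpClamp R z)) (tmin := a) (tmax := b)
      ⟨a, left_mem_Icc.2 hab⟩ z0 (C.toNNReal * (b - a).toNNReal + 1) 1 C.toNNReal K := by
    constructor
    · intro t ht
      have := (hK t ht).comp (s := Metric.closedBall z0 (C.toNNReal * (b - a).toNNReal + 1 : ℝ≥0))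
        ((cpClamp_lip R).lipschitzOnWith) (fun z _ => by simpa using cpClamp_norm hR z)
      rw [mul_one] at this
      exact this
    · intro z _
      exact (hc.comp (by fun_prop : Continuous fun t : ℝ => (t, cpClamp R z))).continuousOn
    · intro t ht z _
      have := hC (t, cpClamp R z) ⟨ht, by simpa using cpClamp_norm hR z⟩
      exact this.trans (Real.le_coe_toNNReal C)
    · have : 0 ≤ b - a := by linarith
      simp [this]
  obtain ⟨α, h1, L', h2⟩ := hPL.exists_forall_mem_closedBall_eq_hasDerivWithinAt_lipschitzOnWith
  exact ⟨α, fun z hz => h1 z (by simpa using hz), L', by simpa using h2⟩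

lemma cpLip_clamp {f : ℝ → (ℝ × ℝ × ℝ × ℝ) → (ℝ × ℝ × ℝ × ℝ)} (hf : CPLip f)
    {R : ℝ} (hR : 0 ≤ R) : CPLip (fun t z => f t (cpClamp R z)) := by
  intro a b r
  obtain ⟨K, hK⟩ := hf a b R
  refine ⟨K, fun t ht => ?_⟩
  have := (hK t ht).comp (s := Metric.closedBall 0 r) ((cpClamp_lip R).lipschitzOnWith)
        (fun z _ => by simpa using cpClamp_norm hR z)
  rw [mul_one] at this
  exact this

/-- Continuous dependence on initial data together with extension past the end point. -/
lemma cp_dep {f : ℝ → (ℝ × ℝ × ℝ × ℝ) → (ℝ × ℝ × ℝ × ℝ)}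
    (hc : Continuous (Function.uncurry f)) (hf : CPLip f) {a b : ℝ} (hab : a ≤ b)
    {γ : ℝ → (ℝ × ℝ × ℝ × ℝ)} (hγ : CPSol f a b γ) {ε : ℝ} (hε : 0 < ε) :
    ∃ η > 0, ∃ δ > 0, ∀ z, dist z (γ a) < δ → ∃ γ' : ℝ → (ℝ × ℝ × ℝ × ℝ),
      γ' a = z ∧ CPSol f a (b + η) γ' ∧ ∀ t ∈ Icc a b, dist (γ' t) (γ t) < ε := by
  obtain ⟨R, hR0, hR⟩ := hγ.bdd
  have hR2 : 0 ≤ R + 2 := by linarith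
  obtain ⟨α, hα, L', hL'⟩ := cp_global hc hf (by linarith : a ≤ b + 1) hR2 (γ a)
  obtain ⟨hα0, hαs⟩ := hα (γ a) (by simp)
  have hγs : CPSol (fun t z => f t (cpClamp (R + 2) z)) a b γ := fun t ht => by
    have := hγ t ht
    simp only
    rwa [cpClamp_eq (by linarith [hR t ht])]
  have heq : EqOn (α (γ a)) γ (Icc a b) :=
    CPSol.unique (cpLip_clamp hf hR2) (hαs.mono (by linarith)) hγs hα0
  have hcb : ContinuousWithinAt (α (γ a)) (Icc a (b + 1)) b := hαs.cont b ⟨hab, by linarith⟩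
  obtain ⟨η, hη, hηb⟩ := Metric.continuousWithinAt_iff.1 hcb 1 one_pos
  have hbound : ∀ t ∈ Icc a (b + min (η / 2) 1), ‖α (γ a) t‖ ≤ R + 1 := by
    intro t ht
    rcases le_total t b with h | h
    · rw [heq ⟨ht.1, h⟩]
      linarith [hR t ⟨ht.1, h⟩]
    · have h1 : t ≤ b + η / 2 := ht.2.trans (by gcongr; exact min_le_left _ _)
      have h2 : t ≤ b + 1 := ht.2.trans (by gcongr; exact min_le_right _ _)
      have h3 := hηb ⟨ht.1, h2⟩ (by rw [Real.dist_eq, abs_of_nonneg (by linarith)]; linarith)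
      have h4 := hR b ⟨hab, le_rfl⟩
      rw [heq ⟨hab, le_rfl⟩, dist_eq_norm] at h3
      have := norm_le_norm_add_norm_sub' (α (γ a) t) (γ b)
      linarith
  set e := min (η / 2) 1 with he
  have he0 : 0 < e := lt_min (by linarith) one_pos
  have he1 : e ≤ 1 := min_le_right _ _
  set δ := min 1 (min ε 1 / (L' + 1)) with hδ
  have hm0 : 0 < min ε 1 := lt_min hε one_pos
  have hL0 : (0 : ℝ) < L' + 1 := by positivity
  refine ⟨e, he0, δ, lt_min one_pos (by positivity), fun z hz => ?_⟩
  have hz1 : z ∈ Metric.closedBall (γ a) 1 := (hz.trans_le (min_le_left _ _)).le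
  obtain ⟨hz0, hzs⟩ := hα z hz1
  have hd : ∀ t ∈ Icc a (b + e), dist (α z t) (α (γ a) t) < min ε 1 := by
    intro t ht
    have h1 : dist (α z t) (α (γ a) t) ≤ L' * dist z (γ a) := (hL' t ⟨ht.1, by linarith [ht.2]⟩).dist_le_mul z hz1 (γ a) (by simp)
    have h2 : dist z (γ a) < min ε 1 / (L' + 1) := hz.trans_le (min_le_right _ _)
    rw [lt_div_iff₀ hL0] at h2
    have : 0 ≤ dist z (γ a) := dist_nonneg
    nlinarith
  refine ⟨α z, hz0, fun t ht => ?_, fun t ht => ?_⟩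
  · have h1 := (hzs.mono (by linarith : b + e ≤ b + 1)) t ht
    have h2 := hd t ht
    have h3 := hbound t ht
    rw [dist_eq_norm] at h2
    have h4 := norm_le_norm_add_norm_sub' (α z t) (α (γ a) t)
    have h5 : min ε 1 ≤ 1 := min_le_right _ _
    simp only at h1
    rwa [cpClamp_eq (by linarith)] at h1
  · rw [← heq ht]
    exact (hd t ⟨ht.1, by linarith [ht.2]⟩).trans_le (min_le_left _ _)

/-- From `z`, some solution stays in `U` and ends in `V`. -/
def CPReach (f : ℝ → (ℝ × ℝ × ℝ × ℝ) → (ℝ × ℝ × ℝ × ℝ)) (a : ℝ)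
    (U V : Set (ℝ × ℝ × ℝ × ℝ)) : Set (ℝ × ℝ × ℝ × ℝ) :=
  {z | ∃ b γ, a ≤ b ∧ CPSol f a b γ ∧ γ a = z ∧ (∀ t ∈ Icc a b, γ t ∈ U) ∧ γ b ∈ V}

lemma cpReach_open {f : ℝ → (ℝ × ℝ × ℝ × ℝ) → (ℝ × ℝ × ℝ × ℝ)}
    (hc : Continuous (Function.uncurry f)) (hf : CPLip f) (a : ℝ)
    {U V : Set (ℝ × ℝ × ℝ × ℝ)} (hU : IsOpen U) (hV : IsOpen V) :
    IsOpen (CPReach f a U V) := by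
  rw [Metric.isOpen_iff]
  rintro z ⟨b, γ, hab, hs, rfl, hUγ, hVγ⟩
  obtain ⟨ε1, hε1, h1⟩ := (isCompact_Icc.image_of_continuousOn hs.cont).exists_thickening_subset_open
    hU (by rintro _ ⟨t, ht, rfl⟩; exact hUγ t ht)
  obtain ⟨ε2, hε2, h2⟩ := Metric.isOpen_iff.1 hV _ hVγ
  obtain ⟨η, hη, δ, hδ, h⟩ := cp_dep hc hf hab hs (lt_min hε1 hε2)
  refine ⟨δ, hδ, fun w hw => ?_⟩
  obtain ⟨γ', h0, hs', hd⟩ := h w hw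
  refine ⟨b, γ', hab, hs'.mono (by linarith), h0, fun t ht => h1 ?_, h2 ?_⟩
  · rw [Metric.mem_thickening_iff]
    exact ⟨γ t, ⟨t, ht, rfl⟩, (hd t ht).trans_le (min_le_left _ _)⟩
  · exact (hd b ⟨hab, le_rfl⟩).trans_le (min_le_right _ _)

lemma cpReach_disj {f : ℝ → (ℝ × ℝ × ℝ × ℝ) → (ℝ × ℝ × ℝ × ℝ)} (hf : CPLip f) (a : ℝ)
    {U V U' V' : Set (ℝ × ℝ × ℝ × ℝ)} (h1 : ∀ z ∈ V, z ∉ U') (h2 : ∀ z ∈ V', z ∉ U)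
    {z : ℝ × ℝ × ℝ × ℝ} (hz : z ∈ CPReach f a U V) (hz' : z ∈ CPReach f a U' V') : False := by
  obtain ⟨b, γ, hab, hs, h0, hU, hV⟩ := hz
  obtain ⟨b', γ', hab', hs', h0', hU', hV'⟩ := hz'
  rcases le_total b b' with h | h
  · have := CPSol.unique hf hs (hs'.mono h) (h0.trans h0'.symm) ⟨hab, le_rfl⟩
    exact h1 _ hV (this ▸ hU' b ⟨hab, h⟩)
  · have := CPSol.unique hf (hs.mono h) hs' (h0.trans h0'.symm) ⟨hab', le_rfl⟩
    exact h2 _ hV' (this ▸ hU b' ⟨hab', h⟩)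

/-- Extension of a solution. -/
lemma cp_ext {f : ℝ → (ℝ × ℝ × ℝ × ℝ) → (ℝ × ℝ × ℝ × ℝ)}
    (hc : Continuous (Function.uncurry f)) (hf : CPLip f) {a b : ℝ} (hab : a ≤ b)
    {γ : ℝ → (ℝ × ℝ × ℝ × ℝ)} (hγ : CPSol f a b γ) :
    ∃ η > 0, ∃ γ' : ℝ → (ℝ × ℝ × ℝ × ℝ), CPSol f a (b + η) γ' ∧ EqOn γ' γ (Icc a b) := by
  obtain ⟨η, hη, δ, hδ, h⟩ := cp_dep hc hf hab hγ one_pos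
  obtain ⟨γ', h0, hs, -⟩ := h (γ a) (by simpa using hδ)
  exact ⟨η, hη, γ', hs, CPSol.unique hf (hs.mono (by linarith)) hγ h0⟩

/-- If the solution stays in `U` up to `b` and its extensions immediately enter `V`,
then the initial point reaches `V`. -/
lemma cp_reach_of {f : ℝ → (ℝ × ℝ × ℝ × ℝ) → (ℝ × ℝ × ℝ × ℝ)}
    (hc : Continuous (Function.uncurry f)) (hf : CPLip f) {a b : ℝ} (hab : a ≤ b)
    {U V : Set (ℝ × ℝ × ℝ × ℝ)} (hU : IsOpen U)
    {γ : ℝ → (ℝ × ℝ × ℝ × ℝ)} (hγ : CPSol f a b γ) (hγU : ∀ t ∈ Icc a b, γ t ∈ U)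
    (hV : ∀ η > 0, ∀ γ', CPSol f a (b + η) γ' → γ' b = γ b →
      ∃ δ > 0, ∀ t ∈ Icc a (b + η), b < t → t < b + δ → γ' t ∈ V) :
    γ a ∈ CPReach f a U V := by
  obtain ⟨η, hη, γ', hs, heq⟩ := cp_ext hc hf hab hγ
  have hb : γ' b = γ b := heq ⟨hab, le_rfl⟩
  obtain ⟨δ, hδ, hδV⟩ := hV η hη γ' hs hb
  have hcb : ContinuousWithinAt γ' (Icc a (b + η)) b := hs.cont b ⟨hab, by linarith⟩
  have hmem : γ' ⁻¹' U ∈ nhdsWithin b (Icc a (b + η)) :=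
    hcb (hU.mem_nhds (by rw [hb]; exact hγU b ⟨hab, le_rfl⟩))
  obtain ⟨ε, hε, hεU⟩ := Metric.mem_nhdsWithin_iff.1 hmem
  set d := min (min δ ε / 2) η with hd
  have hd0 : 0 < d := by positivity
  have hd1 : d ≤ η := min_le_right _ _
  have hd2 : d ≤ min δ ε / 2 := min_le_left _ _
  have hd3 : min δ ε ≤ δ := min_le_left _ _
  have hd4 : min δ ε ≤ ε := min_le_right _ _
  refine ⟨b + d, γ', by linarith, hs.mono (by linarith), heq ⟨le_rfl, hab⟩, fun t ht => ?_,
    hδV _ ⟨by linarith, by linarith⟩ (by linarith) (by linarith)⟩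
  rcases le_or_gt t b with h | h
  · rw [heq ⟨ht.1, h⟩]
    exact hγU t ⟨ht.1, h⟩
  · refine hεU ⟨?_, ht.1, by linarith [ht.2]⟩
    rw [Metric.mem_ball, Real.dist_eq, abs_of_nonneg (by linarith)]
    linarith [ht.2]

/-- The vector field. -/
noncomputable def cpField (m : ℝ) (u : ℝ → ℝ → ℝ → ℝ → ℝ → ℝ) (t : ℝ)
    (z : ℝ × ℝ × ℝ × ℝ) : ℝ × ℝ × ℝ × ℝ :=
  (z.2.1, cartPAcc m u z t, z.2.2.2, cartYAcc m u z t)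

lemma cpField_cont {m : ℝ} (hm : 0 < m) {u : ℝ → ℝ → ℝ → ℝ → ℝ → ℝ}
    (hu_cont : Continuous fun x : ℝ × ℝ × ℝ × ℝ × ℝ =>
      u x.1 x.2.1 x.2.2.1 x.2.2.2.1 x.2.2.2.2) :
    Continuous (Function.uncurry (cpField m u)) := by
  have hu : Continuous fun w : ℝ × (ℝ × ℝ × ℝ × ℝ) =>
      u w.2.1 w.2.2.1 w.2.2.2.1 w.2.2.2.2 w.1 :=
    hu_cont.comp (by fun_prop : Continuous fun w : ℝ × (ℝ × ℝ × ℝ × ℝ) =>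
      (w.2.1, w.2.2.1, w.2.2.2.1, w.2.2.2.2, w.1))
  have hd : ∀ w : ℝ × (ℝ × ℝ × ℝ × ℝ), m + (Real.cos w.2.1) ^ 2 ≠ 0 := fun w => by positivity
  have h1 : Continuous fun w : ℝ × (ℝ × ℝ × ℝ × ℝ) => cartPAcc m u w.2 w.1 := by
    unfold cartPAcc
    exact Continuous.div (by fun_prop) (by fun_prop) hd
  have h2 : Continuous fun w : ℝ × (ℝ × ℝ × ℝ × ℝ) => cartYAcc m u w.2 w.1 := by
    unfold cartYAcc
    exact Continuous.div (by fun_prop) (by fun_prop) hd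
  have : Function.uncurry (cpField m u) =
      fun w : ℝ × (ℝ × ℝ × ℝ × ℝ) => (w.2.2.1, cartPAcc m u w.2 w.1, w.2.2.2.2, cartYAcc m u w.2 w.1) := rfl
  rw [this]
  fun_prop

open scoped NNReal in
/-- Scalar version of `CPLip`. -/
def CPLipS (f : ℝ → (ℝ × ℝ × ℝ × ℝ) → ℝ) : Prop :=
  ∀ a b R : ℝ, ∃ K : ℝ≥0, ∀ t ∈ Icc a b, LipschitzOnWith K (f t) (Metric.closedBall 0 R)

lemma cpLipS_contDiff {g : (ℝ × ℝ × ℝ × ℝ) → ℝ} (hg : ContDiff ℝ 1 g) :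
    CPLipS (fun _ => g) := fun a b R => by
  obtain ⟨K, hK⟩ := hg.contDiffOn.exists_lipschitzOnWith one_ne_zero
    (convex_closedBall 0 R) (isCompact_closedBall 0 R)
  exact ⟨K, fun _ _ => hK⟩

lemma CPLipS.add {f g : ℝ → (ℝ × ℝ × ℝ × ℝ) → ℝ} (hf : CPLipS f) (hg : CPLipS g) :
    CPLipS (fun t z => f t z + g t z) := fun a b R => by
  obtain ⟨K, hK⟩ := hf a b R
  obtain ⟨K', hK'⟩ := hg a b R
  exact ⟨K + K', fun t ht => (hK t ht).add (hK' t ht)⟩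

lemma CPLipS.mul {f g : ℝ → (ℝ × ℝ × ℝ × ℝ) → ℝ} (hf : CPLipS f) (hg : CPLipS g)
    (hfc : Continuous (Function.uncurry f)) (hgc : Continuous (Function.uncurry g)) :
    CPLipS (fun t z => f t z * g t z) := fun a b R => by
  obtain ⟨K, hK⟩ := hf a b R
  obtain ⟨K', hK'⟩ := hg a b R
  obtain ⟨C, hC⟩ := (isCompact_Icc.prod (isCompact_closedBall (0 : ℝ × ℝ × ℝ × ℝ) R)).exists_bound_of_continuousOn
    (s := Icc a b ×ˢ Metric.closedBall (0 : ℝ × ℝ × ℝ × ℝ) R) hfc.continuousOn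
  obtain ⟨C', hC'⟩ := (isCompact_Icc.prod (isCompact_closedBall (0 : ℝ × ℝ × ℝ × ℝ) R)).exists_bound_of_continuousOn
    (s := Icc a b ×ˢ Metric.closedBall (0 : ℝ × ℝ × ℝ × ℝ) R) hgc.continuousOn
  refine ⟨C.toNNReal * K' + C'.toNNReal * K, fun t ht => LipschitzOnWith.of_dist_le_mul
    fun z hz w hw => ?_⟩
  have h1 := (hK t ht).dist_le_mul z hz w hw
  have h2 := (hK' t ht).dist_le_mul z hz w hw
  have h3 : |f t z| ≤ C.toNNReal := (hC (t, z) ⟨ht, hz⟩).trans (Real.le_coe_toNNReal C)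
  have h4 : |g t w| ≤ C'.toNNReal := (hC' (t, w) ⟨ht, hw⟩).trans (Real.le_coe_toNNReal C')
  rw [Real.dist_eq] at h1 h2 ⊢
  have : f t z * g t z - f t w * g t w = f t z * (g t z - g t w) + g t w * (f t z - f t w) := by
    ring
  rw [this]
  refine (abs_add_le _ _).trans ?_
  rw [abs_mul, abs_mul]
  push_cast
  rw [add_mul, mul_assoc, mul_assoc]
  gcongr

lemma cpField_lip {m : ℝ} (hm : 0 < m) {u : ℝ → ℝ → ℝ → ℝ → ℝ → ℝ}
    (hu_cont : Continuous fun x : ℝ × ℝ × ℝ × ℝ × ℝ =>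
      u x.1 x.2.1 x.2.2.1 x.2.2.2.1 x.2.2.2.2)
    (hu_lip : ∀ K : Set (ℝ × ℝ × ℝ × ℝ × ℝ), IsCompact K → ∃ L : ℝ,
      ∀ a ∈ K, ∀ b ∈ K, a.2.2.2.2 = b.2.2.2.2 →
        |u a.1 a.2.1 a.2.2.1 a.2.2.2.1 a.2.2.2.2
          - u b.1 b.2.1 b.2.2.1 b.2.2.2.1 b.2.2.2.2| ≤
          L * dist ((a.1, a.2.1, a.2.2.1, a.2.2.2.1) : ℝ × ℝ × ℝ × ℝ)
                   ((b.1, b.2.1, b.2.2.1, b.2.2.2.1) : ℝ × ℝ × ℝ × ℝ)) :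
    CPLip (cpField m u) := by
  have hu : Continuous fun w : ℝ × (ℝ × ℝ × ℝ × ℝ) =>
      u w.2.1 w.2.2.1 w.2.2.2.1 w.2.2.2.2 w.1 :=
    hu_cont.comp (by fun_prop : Continuous fun w : ℝ × (ℝ × ℝ × ℝ × ℝ) =>
      (w.2.1, w.2.2.1, w.2.2.2.1, w.2.2.2.2, w.1))
  have huL : CPLipS (fun t z => u z.1 z.2.1 z.2.2.1 z.2.2.2 t) := by
    intro a b R
    obtain ⟨L, hL⟩ := hu_lip _ (((isCompact_closedBall (0 : ℝ × ℝ × ℝ × ℝ) R).prod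
      (isCompact_Icc (a := a) (b := b))).image
      (by fun_prop : Continuous fun w : (ℝ × ℝ × ℝ × ℝ) × ℝ =>
        (w.1.1, w.1.2.1, w.1.2.2.1, w.1.2.2.2, w.2)))
    refine ⟨L.toNNReal, fun t ht => LipschitzOnWith.of_dist_le_mul fun z hz w hw => ?_⟩
    have := hL _ ⟨(z, t), ⟨hz, ht⟩, rfl⟩ _ ⟨(w, t), ⟨hw, ht⟩, rfl⟩ rfl
    rw [Real.dist_eq]
    refine this.trans ?_
    gcongr
    exact Real.le_coe_toNNReal L
  have hd : ∀ z : ℝ × ℝ × ℝ × ℝ, m + (Real.cos z.1) ^ 2 ≠ 0 := fun w => by positivity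
  have c1 : ContDiff ℝ 1 fun z : ℝ × ℝ × ℝ × ℝ => Real.sin z.1 / (m + (Real.cos z.1) ^ 2) :=
    ContDiff.div (by fun_prop) (by fun_prop) hd
  have c2 : ContDiff ℝ 1 fun z : ℝ × ℝ × ℝ × ℝ => (z.2.1 ^ 2 * Real.sin z.1 * Real.cos z.1
    - (1 + m) * Real.cos z.1) / (m + (Real.cos z.1) ^ 2) :=
    ContDiff.div (by fun_prop) (by fun_prop) hd
  have c3 : ContDiff ℝ 1 fun z : ℝ × ℝ × ℝ × ℝ => 1 / (m + (Real.cos z.1) ^ 2) :=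
    ContDiff.div (by fun_prop) (by fun_prop) hd
  have c4 : ContDiff ℝ 1 fun z : ℝ × ℝ × ℝ × ℝ => (z.2.1 ^ 2 * Real.cos z.1
    - Real.sin z.1 * Real.cos z.1) / (m + (Real.cos z.1) ^ 2) :=
    ContDiff.div (by fun_prop) (by fun_prop) hd
  have l1 := ((huL.mul (cpLipS_contDiff c1) hu (c1.continuous.comp continuous_snd)).add
    (cpLipS_contDiff c2))
  have l2 := ((huL.mul (cpLipS_contDiff c3) hu (c3.continuous.comp continuous_snd)).add
    (cpLipS_contDiff c4))
  have l3 := cpLipS_contDiff (by fun_prop : ContDiff ℝ 1 fun z : ℝ × ℝ × ℝ × ℝ => z.2.1)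
  have l4 := cpLipS_contDiff (by fun_prop : ContDiff ℝ 1 fun z : ℝ × ℝ × ℝ × ℝ => z.2.2.2)
  intro a b R
  obtain ⟨K1, h1⟩ := l1 a b R
  obtain ⟨K2, h2⟩ := l2 a b R
  obtain ⟨K3, h3⟩ := l3 a b R
  obtain ⟨K4, h4⟩ := l4 a b R
  refine ⟨max K3 (max K1 (max K4 K2)), fun t ht => ?_⟩
  have := (h3 t ht).prodMk ((h1 t ht).prodMk ((h4 t ht).prodMk (h2 t ht)))
  convert this using 2 with z
  · simp only [cpField, cartPAcc, cartYAcc]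
    congr 2
    · ring
    · congr 1
      ring

/-- Immediate descent. -/
lemma cp_descent {q p : ℝ → ℝ} {a b T c : ℝ} (haT : a ≤ T) (_hTb : T < b)
    (hq : ∀ t ∈ Icc a b, HasDerivWithinAt q (p t) (Icc a b) t)
    (hp : HasDerivWithinAt p c (Icc a b) T) (hc : c < 0) (hpT : p T ≤ 0) :
    ∃ δ > 0, ∀ t ∈ Icc a b, T < t → t < T + δ → q t < q T := by
  have hp' : HasDerivWithinAt p c (Ioc T b) T := hp.mono fun t ht => ⟨haT.trans ht.1.le, ht.2⟩
  rw [hasDerivWithinAt_iff_tendsto_slope' (by simp)] at hp'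
  have hev := hp'.eventually (gt_mem_nhds hc)
  obtain ⟨δ, hδ, h⟩ := Metric.mem_nhdsWithin_iff.1 hev
  have hneg : ∀ t ∈ Ioc T b, t < T + δ → p t < 0 := by
    intro t ht ht'
    have h1 : slope p T t < 0 := h ⟨by
      rw [Metric.mem_ball, Real.dist_eq, abs_of_pos (by linarith [ht.1])]; linarith, ht⟩
    rw [slope_def_field, div_lt_iff₀ (by linarith [ht.1])] at h1
    linarith
  refine ⟨δ, hδ, fun t ht h1 h2 => ?_⟩
  have hanti : StrictAntiOn q (Icc T t) := by
    apply strictAntiOn_of_deriv_neg (convex_Icc _ _)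
    · intro s hs
      exact (hq s ⟨haT.trans hs.1, hs.2.trans ht.2⟩).continuousWithinAt.mono
        (Icc_subset_Icc haT ht.2)
    · intro s hs
      rw [interior_Icc] at hs
      have := (hq s ⟨haT.trans hs.1.le, hs.2.le.trans ht.2⟩).hasDerivAt
        (Icc_mem_nhds (by linarith [hs.1]) (by linarith [hs.2, ht.2]))
      rw [this.deriv]
      exact hneg s ⟨hs.1, hs.2.le.trans ht.2⟩ (by linarith [hs.2])
  exact hanti ⟨le_rfl, h1.le⟩ ⟨h1.le, le_rfl⟩ h1

/-- Sign of the velocity at the first hitting time from above. -/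
lemma cp_left_sign {q : ℝ → ℝ} {a T c : ℝ} (haT : a < T)
    (hq : HasDerivWithinAt q c (Icc a T) T) (h : ∀ t ∈ Ico a T, q T ≤ q t) : c ≤ 0 := by
  have hq' : HasDerivWithinAt q c (Ico a T) T := hq.mono Ico_subset_Icc_self
  rw [hasDerivWithinAt_iff_tendsto_slope' (by simp)] at hq'
  have : (nhdsWithin T (Ico a T)).NeBot := by
    rw [← mem_closure_iff_nhdsWithin_neBot, closure_Ico haT.ne]
    exact ⟨haT.le, le_rfl⟩
  refine le_of_tendsto hq' (eventually_nhdsWithin_of_forall fun t ht => ?_)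
  rw [slope_def_field]
  exact div_nonpos_of_nonneg_of_nonpos (by linarith [h t ht]) (by linarith [ht.2])

lemma cp_comp {m : ℝ} {u : ℝ → ℝ → ℝ → ℝ → ℝ → ℝ} {a b : ℝ}
    {γ : ℝ → (ℝ × ℝ × ℝ × ℝ)} (h : CPSol (cpField m u) a b γ) (t : ℝ) (ht : t ∈ Icc a b) :
    HasDerivWithinAt (fun t => (γ t).1) (γ t).2.1 (Icc a b) t ∧
    HasDerivWithinAt (fun t => (γ t).2.1) (cartPAcc m u (γ t) t) (Icc a b) t ∧
    HasDerivWithinAt (fun t => (γ t).2.2.1) (γ t).2.2.2 (Icc a b) t ∧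
    HasDerivWithinAt (fun t => (γ t).2.2.2) (cartYAcc m u (γ t) t) (Icc a b) t := by
  have h0 := h t ht
  have h1 := (hasFDerivAt_fst (𝕜 := ℝ) (p := γ t)).comp_hasDerivWithinAt t h0
  have h2 := (hasFDerivAt_snd (𝕜 := ℝ) (p := γ t)).comp_hasDerivWithinAt t h0
  have h3 := (hasFDerivAt_fst (𝕜 := ℝ) (p := (γ t).2)).comp_hasDerivWithinAt t h2
  have h4 := (hasFDerivAt_snd (𝕜 := ℝ) (p := (γ t).2)).comp_hasDerivWithinAt t h2
  have h5 := (hasFDerivAt_fst (𝕜 := ℝ) (p := (γ t).2.2)).comp_hasDerivWithinAt t h4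
  have h6 := (hasFDerivAt_snd (𝕜 := ℝ) (p := (γ t).2.2)).comp_hasDerivWithinAt t h4
  exact ⟨h1, h3, h5, h6⟩

lemma cp_closed_limit {γ : ℝ → (ℝ × ℝ × ℝ × ℝ)} {a T : ℝ} (haT : a < T)
    (hγ : ContinuousOn γ (Icc a T)) {G : Set (ℝ × ℝ × ℝ × ℝ)} (hG : IsClosed G)
    (h : ∀ t ∈ Ico a T, γ t ∈ G) : γ T ∈ G := by
  have : (nhdsWithin T (Ico a T)).NeBot := by
    rw [← mem_closure_iff_nhdsWithin_neBot, closure_Ico haT.ne]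
    exact ⟨haT.le, le_rfl⟩
  have hc : ContinuousWithinAt γ (Ico a T) T :=
    (hγ T ⟨haT.le, le_rfl⟩).mono Ico_subset_Icc_self
  exact hG.mem_of_tendsto hc (eventually_nhdsWithin_of_forall h)

lemma cp_exit_left {m : ℝ} (hm : 0 < m) {u : ℝ → ℝ → ℝ → ℝ → ℝ → ℝ}
    (hc : Continuous (Function.uncurry (cpField m u))) (hf : CPLip (cpField m u))
    {U : Set (ℝ × ℝ × ℝ × ℝ)} (hU : IsOpen U) {a b : ℝ} (hab : a ≤ b)
    {γ : ℝ → (ℝ × ℝ × ℝ × ℝ)} (h : CPSol (cpField m u) a b γ)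
    (hγU : ∀ t ∈ Icc a b, γ t ∈ U) (hq : (γ b).1 = 0) (hp : (γ b).2.1 ≤ 0) :
    γ a ∈ CPReach (cpField m u) a U {z | z.1 < 0} := by
  refine cp_reach_of hc hf hab hU h hγU fun η hη γ' hs hb => ?_
  have hbm : b ∈ Icc a (b + η) := ⟨hab, by linarith⟩
  have hneg : cartPAcc m u (γ' b) b < 0 := by
    rw [hb]
    simp only [cartPAcc, hq, Real.sin_zero, Real.cos_zero]
    apply div_neg_of_neg_of_pos <;> nlinarith
  obtain ⟨δ, hδ, hd⟩ := cp_descent hab (by linarith : b < b + η)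
    (fun t ht => (cp_comp hs t ht).1) (cp_comp hs b hbm).2.1 hneg (by simpa only [hb] using hp)
  refine ⟨δ, hδ, fun t ht h1 h2 => ?_⟩
  have := hd t ht h1 h2
  simp only [hb, hq] at this
  exact this

lemma cp_exit_right {m : ℝ} (hm : 0 < m) {u : ℝ → ℝ → ℝ → ℝ → ℝ → ℝ}
    (hc : Continuous (Function.uncurry (cpField m u))) (hf : CPLip (cpField m u))
    {U V : Set (ℝ × ℝ × ℝ × ℝ)} (hU : IsOpen U) (hV : {z | π < z.1} ⊆ V) {a b : ℝ} (hab : a ≤ b)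
    {γ : ℝ → (ℝ × ℝ × ℝ × ℝ)} (h : CPSol (cpField m u) a b γ)
    (hγU : ∀ t ∈ Icc a b, γ t ∈ U) (hq : (γ b).1 = π) (hp : 0 ≤ (γ b).2.1) :
    γ a ∈ CPReach (cpField m u) a U V := by
  refine cp_reach_of hc hf hab hU h hγU fun η hη γ' hs hb => ?_
  have hbm : b ∈ Icc a (b + η) := ⟨hab, by linarith⟩
  have hpos : 0 < cartPAcc m u (γ' b) b := by
    rw [hb]
    simp only [cartPAcc, hq, Real.sin_pi, Real.cos_pi]
    apply div_pos <;> nlinarith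
  obtain ⟨δ, hδ, hd⟩ := cp_descent (q := fun t => -(γ' t).1) (p := fun t => -(γ' t).2.1)
    hab (by linarith : b < b + η)
    (fun t ht => (cp_comp hs t ht).1.neg) (cp_comp hs b hbm).2.1.neg (by linarith)
    (by simpa only [hb, neg_nonpos] using hp)
  refine ⟨δ, hδ, fun t ht h1 h2 => hV ?_⟩
  have := hd t ht h1 h2
  simp only [hb, hq] at this
  simp only [mem_ofPred_eq]
  linarith

lemma cp_const {f : ℝ → (ℝ × ℝ × ℝ × ℝ) → (ℝ × ℝ × ℝ × ℝ)} (a : ℝ) (z : ℝ × ℝ × ℝ × ℝ) :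
    CPSol f a a (fun _ => z) := by
  intro t ht
  have : t = a := le_antisymm ht.2 ht.1
  subst this
  rw [Icc_self]
  rw [hasDerivWithinAt_iff_tendsto_slope]
  simp

/-- Partial stabilization of the cart pendulum in the variables `(q,p)` alone cannot be
global: if `B₀` is a compact subset of the strip `{0 < q < π}` in the `(q,p)`-plane such
that every solution touching `∂B₀ × ℝ²` at any time `t ≥ t₀` immediately enters
`int B₀ × ℝ²`, then some solution starting outside `B₀` (with `0 < q₀ < π`) keeps
`(q(t), p(t))` in the strip and outside `B₀` for all `t ≥ t₀` in its interval of
existence. -/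
theorem cart_pendulum_no_global_partial_stabilization
    (m : ℝ) (hm : 0 < m)
    (u : ℝ → ℝ → ℝ → ℝ → ℝ → ℝ)
    (hu_cont : Continuous fun x : ℝ × ℝ × ℝ × ℝ × ℝ =>
      u x.1 x.2.1 x.2.2.1 x.2.2.2.1 x.2.2.2.2)
    (hu_lip : ∀ K : Set (ℝ × ℝ × ℝ × ℝ × ℝ), IsCompact K → ∃ L : ℝ,
      ∀ a ∈ K, ∀ b ∈ K, a.2.2.2.2 = b.2.2.2.2 →
        |u a.1 a.2.1 a.2.2.1 a.2.2.2.1 a.2.2.2.2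
          - u b.1 b.2.1 b.2.2.1 b.2.2.2.1 b.2.2.2.2| ≤
          L * dist ((a.1, a.2.1, a.2.2.1, a.2.2.2.1) : ℝ × ℝ × ℝ × ℝ)
                   ((b.1, b.2.1, b.2.2.1, b.2.2.2.1) : ℝ × ℝ × ℝ × ℝ))
    (t₀ : ℝ)
    (B₀ : Set (ℝ × ℝ)) (hB₀compact : IsCompact B₀)
    (hB₀strip : B₀ ⊆ {z : ℝ × ℝ | 0 < z.1 ∧ z.1 < π})
    -- every solution touching `∂B₀` at some time `t₁ ≥ t₀` immediately enters `int B₀`: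
    (hcapture : ∀ t₁ : ℝ, t₀ ≤ t₁ →
      ∀ I : Set ℝ, t₁ ∈ I → I.OrdConnected →
        ∀ q p x y : ℝ → ℝ,
          (∀ t ∈ I, HasDerivWithinAt q (p t) I t) →
          (∀ t ∈ I, HasDerivWithinAt p (cartPAcc m u (q t, p t, x t, y t) t) I t) →
          (∀ t ∈ I, HasDerivWithinAt x (y t) I t) →
          (∀ t ∈ I, HasDerivWithinAt y (cartYAcc m u (q t, p t, x t, y t) t) I t) →
          (q t₁, p t₁) ∈ frontier B₀ →
          ∃ δ > 0, ∀ s ∈ I, t₁ < s → s < t₁ + δ → (q s, p s) ∈ interior B₀) :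
    ∃ q₀ p₀ x₀ y₀ : ℝ,
      0 < q₀ ∧ q₀ < π ∧ (q₀, p₀) ∉ B₀ ∧
      ∀ I : Set ℝ, t₀ ∈ I → I.OrdConnected →
        ∀ q p x y : ℝ → ℝ,
          (∀ t ∈ I, HasDerivWithinAt q (p t) I t) →
          (∀ t ∈ I, HasDerivWithinAt p (cartPAcc m u (q t, p t, x t, y t) t) I t) →
          (∀ t ∈ I, HasDerivWithinAt x (y t) I t) →
          (∀ t ∈ I, HasDerivWithinAt y (cartYAcc m u (q t, p t, x t, y t) t) I t) →
          q t₀ = q₀ → p t₀ = p₀ → x t₀ = x₀ → y t₀ = y₀ →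
          ∀ t ∈ I, t₀ ≤ t →
            (0 < q t ∧ q t < π) ∧ (q t, p t) ∉ B₀ := by
  have hc := cpField_cont hm hu_cont
  have hf := cpField_lip hm hu_cont hu_lip
  have hproj : Continuous fun z : ℝ × ℝ × ℝ × ℝ => (z.1, z.2.1) := by fun_prop
  set UA : Set (ℝ × ℝ × ℝ × ℝ) := {z | z.1 < π ∧ (z.1, z.2.1) ∉ B₀} with hUA
  set VA : Set (ℝ × ℝ × ℝ × ℝ) := {z | z.1 < 0} with hVA
  set UC : Set (ℝ × ℝ × ℝ × ℝ) := {z | 0 < z.1} with hUC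
  set VC : Set (ℝ × ℝ × ℝ × ℝ) := {z | π < z.1 ∨ (z.1, z.2.1) ∈ interior B₀} with hVC
  have oUA : IsOpen UA := (isOpen_lt continuous_fst continuous_const).inter
    (hB₀compact.isClosed.isOpen_compl.preimage hproj)
  have oVA : IsOpen VA := isOpen_lt continuous_fst continuous_const
  have oUC : IsOpen UC := isOpen_lt continuous_const continuous_fst
  have oVC : IsOpen VC := (isOpen_lt continuous_const continuous_fst).union
    (isOpen_interior.preimage hproj)
  have oA := cpReach_open hc hf t₀ oUA oVA
  have oC := cpReach_open hc hf t₀ oUC oVC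
  have hdisj : ∀ z, z ∈ CPReach (cpField m u) t₀ UA VA → z ∈ CPReach (cpField m u) t₀ UC VC →
      False := fun z => cpReach_disj hf t₀
    (fun z (hz : z.1 < 0) (hz' : 0 < z.1) => by linarith)
    (fun z hz hz' => hz.elim (fun h => by linarith [hz'.1])
      (fun h => hz'.2 (interior_subset h)))
  -- choice of the slope of the initial segment
  obtain ⟨C, hC⟩ := hB₀compact.exists_bound_of_continuousOn
    (f := fun z : ℝ × ℝ => z.2 / z.1)
    (continuousOn_snd.div continuousOn_fst fun z hz => (hB₀strip hz).1.ne')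
  set M : ℝ := max C 0 + 1 with hM
  have hM0 : 0 < M := by positivity
  have hMB : ∀ s : ℝ, (s, M * s) ∉ B₀ := fun s hs => by
    have h1 := hC _ hs
    have h2 : 0 < s := (hB₀strip hs).1
    simp only [mul_div_cancel_right₀ M h2.ne', Real.norm_eq_abs, abs_of_pos hM0] at h1
    linarith [le_max_left C 0]
  set ζ : ℝ → ℝ × ℝ × ℝ × ℝ := fun s => (s, M * s, 0, 0) with hζ
  have cζ : Continuous ζ := by fun_prop
  have h0A : ζ 0 ∈ CPReach (cpField m u) t₀ UA VA :=
    cp_exit_left hm hc hf oUA le_rfl (cp_const t₀ (ζ 0))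
      (fun _ _ => ⟨Real.pi_pos, hMB 0⟩) rfl (by simp [hζ])
  have hπC : ζ π ∈ CPReach (cpField m u) t₀ UC VC :=
    cp_exit_right hm hc hf oUC (fun z hz => Or.inl hz) le_rfl (cp_const t₀ (ζ π))
      (fun _ _ => Real.pi_pos) rfl (by simp only [hζ]; positivity)
  obtain ⟨s, hs, hsA, hsC⟩ : ∃ s ∈ Icc (0 : ℝ) π, ζ s ∉ CPReach (cpField m u) t₀ UA VA ∧
      ζ s ∉ CPReach (cpField m u) t₀ UC VC := by
    by_contra hcon
    push Not at hcon
    obtain ⟨s, -, h1, h2⟩ := isPreconnected_Icc (a := (0 : ℝ)) (b := π) _ _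
      (oA.preimage cζ) (oC.preimage cζ)
      (fun s hs => by
        by_cases h : ζ s ∈ CPReach (cpField m u) t₀ UA VA
        · exact Or.inl h
        · exact Or.inr (hcon s hs h))
      ⟨0, ⟨le_rfl, Real.pi_pos.le⟩, h0A⟩ ⟨π, ⟨Real.pi_pos.le, le_rfl⟩, hπC⟩
    exact hdisj _ h1 h2
  have hs0 : 0 < s := lt_of_le_of_ne hs.1 fun h => hsA (h ▸ h0A)
  have hsπ : s < π := lt_of_le_of_ne hs.2 fun h => hsC (h ▸ hπC)
  refine ⟨s, M * s, 0, 0, hs0, hsπ, hMB s, ?_⟩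
  intro I hI hIc q p x y hq hp hx hy hq0 hp0 hx0 hy0 t ht htt
  by_contra hbad
  set γ : ℝ → ℝ × ℝ × ℝ × ℝ := fun τ => (q τ, p τ, x τ, y τ) with hγ
  have hsub : Icc t₀ t ⊆ I := hIc.out hI ht
  have hsol : CPSol (cpField m u) t₀ t γ := fun τ hτ =>
    ((hq τ (hsub hτ)).prodMk ((hp τ (hsub hτ)).prodMk
      ((hx τ (hsub hτ)).prodMk (hy τ (hsub hτ))))).mono hsub
  have hγ0 : γ t₀ = ζ s := by simp [hγ, hζ, hq0, hp0, hx0, hy0]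
  set F : Set (ℝ × ℝ × ℝ × ℝ) := {z | z.1 ≤ 0 ∨ π ≤ z.1 ∨ (z.1, z.2.1) ∈ B₀} with hF
  have cF : IsClosed F := (isClosed_le continuous_fst continuous_const).union
    ((isClosed_le continuous_const continuous_fst).union
      (hB₀compact.isClosed.preimage hproj))
  have htF : γ t ∈ F := by
    by_contra h
    simp only [hF, mem_ofPred_eq, not_or, not_le] at h
    exact hbad ⟨⟨h.1, h.2.1⟩, h.2.2⟩
  have hcomp : IsCompact (Icc t₀ t ∩ γ ⁻¹' F) :=
    isCompact_Icc.of_isClosed_subset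
      (hsol.cont.preimage_isClosed_of_isClosed isClosed_Icc cF) inter_subset_left
  obtain ⟨T, ⟨hTI, hTF⟩, hTmin⟩ := hcomp.exists_isLeast ⟨t, ⟨htt, le_rfl⟩, htF⟩
  have hbefore : ∀ τ ∈ Ico t₀ T, γ τ ∉ F := fun τ hτ hτF =>
    absurd (hTmin ⟨⟨hτ.1, hτ.2.le.trans hTI.2⟩, hτF⟩) (not_le.2 hτ.2)
  have hT0 : t₀ < T := by
    refine lt_of_le_of_ne hTI.1 fun h => ?_
    rw [mem_preimage, ← h, hγ0] at hTF
    rcases hTF with h | h | h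
    · exact absurd hs0 (not_lt.2 h)
    · exact absurd hsπ (not_lt.2 h)
    · exact hMB s h
  have hsT : CPSol (cpField m u) t₀ T γ := hsol.mono hTI.2
  have hnF : ∀ τ ∈ Ico t₀ T, 0 < q τ ∧ q τ < π ∧ (q τ, p τ) ∉ B₀ := fun τ hτ => by
    have := hbefore τ hτ
    simp only [hF, mem_ofPred_eq, not_or, not_le] at this
    exact this
  have hqT0 : 0 ≤ q T := cp_closed_limit hT0 hsT.cont
    (isClosed_le continuous_const continuous_fst) fun τ hτ => (hnF τ hτ).1.le
  have hqTπ : q T ≤ π := cp_closed_limit hT0 hsT.cont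
    (isClosed_le continuous_fst continuous_const) fun τ hτ => (hnF τ hτ).2.1.le
  have hder := (cp_comp hsT T ⟨hT0.le, le_rfl⟩).1
  by_cases hB : (q T, p T) ∈ B₀
  · -- capture
    have hfr : (q T, p T) ∈ frontier B₀ := by
      rw [frontier_eq_closure_inter_closure]
      exact ⟨subset_closure hB, cp_closed_limit hT0 hsT.cont
        (isClosed_closure.preimage hproj) fun τ hτ => subset_closure (hnF τ hτ).2.2⟩
    apply hsC
    rw [← hγ0]
    refine cp_reach_of hc hf hT0.le oUC hsT (fun τ hτ => ?_) fun η hη γ' hs' hb => ?_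
    · rcases hτ.2.lt_or_eq with h | h
      · exact (hnF τ ⟨hτ.1, h⟩).1
      · rw [h]
        exact (hB₀strip hB).1
    · obtain ⟨δ, hδ, hd⟩ := hcapture T hT0.le (Icc t₀ (T + η)) ⟨hT0.le, by linarith⟩
        ordConnected_Icc (fun τ => (γ' τ).1) (fun τ => (γ' τ).2.1) (fun τ => (γ' τ).2.2.1)
        (fun τ => (γ' τ).2.2.2) (fun τ hτ => (cp_comp hs' τ hτ).1)
        (fun τ hτ => (cp_comp hs' τ hτ).2.1) (fun τ hτ => (cp_comp hs' τ hτ).2.2.1)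
        (fun τ hτ => (cp_comp hs' τ hτ).2.2.2) (by simpa only [hb] using hfr)
      exact ⟨δ, hδ, fun τ hτ h1 h2 => Or.inr (hd τ hτ h1 h2)⟩
  · rcases hTF with h | h | h
    · have hqT : q T = 0 := le_antisymm h hqT0
      apply hsA
      rw [← hγ0]
      refine cp_exit_left hm hc hf oUA hT0.le hsT (fun τ hτ => ?_) hqT
        (cp_left_sign hT0 hder fun τ hτ => ?_)
      · rcases hτ.2.lt_or_eq with h | h
        · exact (hnF τ ⟨hτ.1, h⟩).2
        · rw [h]
          exact ⟨by simp only [hγ, hqT]; exact Real.pi_pos, hB⟩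
      · simp only [hγ, hqT]
        exact (hnF τ hτ).1.le
    · have hqT : q T = π := le_antisymm hqTπ h
      apply hsC
      rw [← hγ0]
      refine cp_exit_right hm hc hf oUC (fun z hz => Or.inl hz) hT0.le hsT (fun τ hτ => ?_) hqT
        (neg_nonpos.1 (cp_left_sign hT0 hder.neg fun τ hτ => ?_))
      · rcases hτ.2.lt_or_eq with h | h
        · exact (hnF τ ⟨hτ.1, h⟩).1
        · rw [h]
          simp only [hUC, hγ, mem_ofPred_eq, hqT]
          exact Real.pi_pos
      · simp only [hγ, hqT, Pi.neg_apply]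
        linarith [(hnF τ hτ).2.1]
    · exact hB h
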